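/- Let H be an m×n matrix over GF(2), let j be a column index, and suppose column j has exactly two nonzero entries, at distinct rows i₁ and i₂ (a degree-2 hidden variable node). Let H' be obtained from H by replacing rows i₁ and i₂ with their GF(2)-sum (a single merged row, in which the entry in column j is 0), deleting the other of the two rows, and deleting column j. Then the map sending x to its restriction to the coordinates other than j is a surjection from {x | H·x = 0} onto {y | H'·y = 0}, and it is a bijection: each y in the reduced null space lifts to exactly one x in the original null space, with x j determined by row i₁. Hence the pruning step that removes a degree-2 hidden variable node and merges its two check nodes preserves the code on the remaining variables. -/

import Mathlib

open Matrix

theorem Matrix.mulVec_apply_eq_add_sum_ne {ι κ R : Type*} [Fintype κ] [DecidableEq κ]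
    [CommSemiring R] (A : Matrix ι κ R) (x : κ → R) (r : ι) (j : κ) :
    (A *ᵥ x) r = A r j * x j + ∑ c : {c : κ // c ≠ j}, A r c.1 * x c.1 :=
  Fintype.sum_eq_add_sum_subtype_ne (fun c => A r c * x c) j

/-- Kernel membership for a matrix over GF(2) whose column `j` is supported on `{i₁, i₂}`. -/
theorem Matrix.mulVec_eq_zero_iff_of_col_support_pair {ι κ : Type*} [Fintype κ] [DecidableEq κ]
    (H : Matrix ι κ (ZMod 2)) {i₁ i₂ : ι} {j : κ} (h1 : H i₁ j ≠ 0) (h2 : H i₂ j ≠ 0)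
    (hcol : ∀ r, r ≠ i₁ → r ≠ i₂ → H r j = 0) (x : κ → ZMod 2) :
    H *ᵥ x = 0 ↔
      x j = ∑ c : {c : κ // c ≠ j}, H i₁ c.1 * x c.1 ∧
      x j = ∑ c : {c : κ // c ≠ j}, H i₂ c.1 * x c.1 ∧
      ∀ r, r ≠ i₁ → r ≠ i₂ → ∑ c : {c : κ // c ≠ j}, H r c.1 * x c.1 = 0 := by
  have key : ∀ a b s : ZMod 2, a ≠ 0 → (a * b + s = 0 ↔ b = s) := by decide
  simp only [funext_iff, mulVec_apply_eq_add_sum_ne H x _ j, Pi.zero_apply]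
  refine ⟨fun h => ⟨(key _ _ _ h1).1 (h i₁), (key _ _ _ h2).1 (h i₂), fun r hr1 hr2 => ?_⟩, ?_⟩
  · simpa [hcol r hr1 hr2] using h r
  · rintro ⟨e1, e2, e⟩ r
    by_cases hr1 : r = i₁
    · subst hr1
      exact (key _ _ _ h1).2 e1
    by_cases hr2 : r = i₂
    · subst hr2
      exact (key _ _ _ h2).2 e2
    rw [hcol r hr1 hr2, zero_mul, zero_add, e r hr1 hr2]

/-- Kernel membership for the matrix over GF(2) obtained by merging rows `i₁` and `i₂` into their
sum and deleting row `i₂` and column `j`. -/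
theorem Matrix.mergeRows_mulVec_eq_zero_iff {ι κ : Type*} [DecidableEq ι] [Fintype κ]
    [DecidableEq κ] (H : Matrix ι κ (ZMod 2)) {i₁ i₂ : ι} (hi12 : i₁ ≠ i₂) (j : κ)
    (y : {c : κ // c ≠ j} → ZMod 2) :
    (Matrix.of fun (r : {r : ι // r ≠ i₂}) (c : {c : κ // c ≠ j}) =>
        if r.1 = i₁ then H i₁ c.1 + H i₂ c.1 else H r.1 c.1) *ᵥ y = 0 ↔
      ∑ c : {c : κ // c ≠ j}, H i₁ c.1 * y c = ∑ c : {c : κ // c ≠ j}, H i₂ c.1 * y c ∧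
      ∀ r, r ≠ i₁ → r ≠ i₂ → ∑ c : {c : κ // c ≠ j}, H r c.1 * y c = 0 := by
  have key : ∀ a b : ZMod 2, a + b = 0 ↔ a = b := by decide
  simp only [funext_iff, mulVec, dotProduct, of_apply, Pi.zero_apply]
  constructor
  · refine fun h => ⟨?_, fun r hr1 hr2 => ?_⟩
    · rw [← key, ← Finset.sum_add_distrib]
      simpa only [if_true, add_mul] using h ⟨i₁, hi12⟩
    · simpa only [if_neg hr1] using h ⟨r, hr2⟩
  · rintro ⟨e, h⟩ ⟨r, hr2⟩
    by_cases hr1 : r = i₁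
    · simp only [if_pos hr1, add_mul, Finset.sum_add_distrib]
      exact (key _ _).2 e
    · simpa only [if_neg hr1] using h r hr1 hr2

/-- If column `j` of `H` has exactly two nonzero entries, at distinct
rows `i₁` and `i₂` (a degree-2 hidden variable node), then the matrix `H'` obtained by
replacing rows `i₁, i₂` by their GF(2)-sum (kept as the merged row `i₁`), deleting the
other row `i₂`, and deleting column `j`, is such that restriction to the coordinates
other than `j` is a surjection — indeed a bijection — from the null space of `H` onto
the null space of `H'`. -/
theorem stmt15 {m n : ℕ} (H : Matrix (Fin m) (Fin n) (ZMod 2)) (i₁ i₂ : Fin m)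
    (hi12 : i₁ ≠ i₂) (j : Fin n)
    (h1 : H i₁ j ≠ 0) (h2 : H i₂ j ≠ 0)
    (hcol : ∀ r : Fin m, r ≠ i₁ → r ≠ i₂ → H r j = 0) :
    Set.SurjOn (fun (x : Fin n → ZMod 2) (c : {c : Fin n // c ≠ j}) => x c.1)
      {x : Fin n → ZMod 2 | H.mulVec x = 0}
      {y : {c : Fin n // c ≠ j} → ZMod 2 |
        (Matrix.of fun (r : {r : Fin m // r ≠ i₂}) (c : {c : Fin n // c ≠ j}) =>
          if r.1 = i₁ then H i₁ c.1 + H i₂ c.1 else H r.1 c.1).mulVec y = 0} ∧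
    Set.BijOn (fun (x : Fin n → ZMod 2) (c : {c : Fin n // c ≠ j}) => x c.1)
      {x : Fin n → ZMod 2 | H.mulVec x = 0}
      {y : {c : Fin n // c ≠ j} → ZMod 2 |
        (Matrix.of fun (r : {r : Fin m // r ≠ i₂}) (c : {c : Fin n // c ≠ j}) =>
          if r.1 = i₁ then H i₁ c.1 + H i₂ c.1 else H r.1 c.1).mulVec y = 0} := by
  have hker := H.mulVec_eq_zero_iff_of_col_support_pair h1 h2 hcol
  have hmerge := H.mergeRows_mulVec_eq_zero_iff hi12 j
  refine (fun h => ⟨h.surjOn, h⟩) ⟨?_, ?_, ?_⟩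
  · intro x hx
    obtain ⟨e1, e2, e⟩ := (hker x).1 hx
    exact (hmerge _).2 ⟨e1.symm.trans e2, e⟩
  · intro x hx x' hx' hxx
    have hne : ∀ c : {c : Fin n // c ≠ j}, x c.1 = x' c.1 := congrFun hxx
    funext c
    by_cases hc : c = j
    · subst hc
      rw [((hker x).1 hx).1, ((hker x').1 hx').1]
      exact Finset.sum_congr rfl fun d _ => by rw [hne d]
    · exact hne ⟨c, hc⟩
  · intro y hy
    obtain ⟨e, h⟩ := (hmerge y).1 hy
    let x : Fin n → ZMod 2 := fun c =>
      if hc : c ≠ j then y ⟨c, hc⟩ else ∑ d : {d : Fin n // d ≠ j}, H i₁ d.1 * y d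
    have hxj : x j = ∑ d : {d : Fin n // d ≠ j}, H i₁ d.1 * y d := dif_neg (not_not.2 rfl)
    have hxy : ∀ c : {c : Fin n // c ≠ j}, x c.1 = y c := fun c => dif_pos c.2
    refine ⟨x, (hker x).2 ?_, funext hxy⟩
    simp only [hxy]
    exact ⟨hxj, hxj.trans e, h⟩
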